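/- arXiv:1506.00728 — 2 statements merged into one kernel-verified Lean document; each statement's English description precedes it below -/
import Mathlib

section
/- Fix n ≥ 2, a vector b : Fin n → ℝ, a constant c > 0, indices i ≠ j, and a symmetric {0,1}-matrix pair G⁰, G¹ agreeing in all entries except G¹_{ij} = G¹_{ji} = 1 and G⁰_{ij} = G⁰_{ji} = 0. For every configuration η ∈ {0,1}^n with η_i = 1 and η_j = 1, the normalized Ising probabilities satisfy w(η, G¹)/Z(G¹) > w(η, G⁰)/Z(G⁰). -/
/-- The Ising weight of a configuration `η` for the graph (adjacency matrix) `G`: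
`w(η, G) = exp(Σ_k b_k η_k + c · Σ_{k,l} η_k G_{k,l} η_l)`. -/
noncomputable def isingW {n : ℕ} (b : Fin n → ℝ) (c : ℝ) (η : Fin n → ℝ)
    (G : Fin n → Fin n → ℝ) : ℝ :=
  Real.exp ((∑ k, b k * η k) + c * ∑ k, ∑ l, η k * G k l * η l)

/-- The Ising partition function: the sum of `w(η, G)` over all `2^n`
configurations `η ∈ {0,1}^n`. -/
noncomputable def isingZ {n : ℕ} (b : Fin n → ℝ) (c : ℝ)
    (G : Fin n → Fin n → ℝ) : ℝ :=
  ∑ σ : Fin n → Bool, isingW b c (fun k => if σ k then 1 else 0) G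

theorem isingW_edge {n : ℕ} (b : Fin n → ℝ) (c : ℝ)
    (i j : Fin n) (hij : i ≠ j)
    (G0 G1 : Fin n → Fin n → ℝ)
    (hG0sym : ∀ k l, G0 k l = G0 l k) (hG1sym : ∀ k l, G1 k l = G1 l k)
    (hG1ij : G1 i j = 1) (hG0ij : G0 i j = 0)
    (hagree : ∀ k l, ¬((k = i ∧ l = j) ∨ (k = j ∧ l = i)) → G0 k l = G1 k l)
    (η : Fin n → ℝ) :
    isingW b c η G1 = isingW b c η G0 * Real.exp (2 * c * (η i * η j)) := by
  have hG : ∀ k l, η k * G1 k l * η l = η k * G0 k l * η l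
      + (if k = i then (if l = j then η i * η j else 0) else 0)
      + (if k = j then (if l = i then η i * η j else 0) else 0) := by
    intro k l
    have h1 := hG1sym i j
    have h0 := hG0sym i j
    by_cases hA : k = i ∧ l = j
    · obtain ⟨rfl, rfl⟩ := hA
      simp [hij, hG1ij, hG0ij]
    · by_cases hB : k = j ∧ l = i
      · obtain ⟨rfl, rfl⟩ := hB
        simp [hij.symm, ← h1, ← h0, hG1ij, hG0ij]
        ring
      · rw [hagree k l (by tauto)]
        split_ifs <;> first | tauto | simp
  unfold isingW
  rw [← Real.exp_add]
  congr 1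
  simp only [hG, Finset.sum_add_distrib]
  simp
  ring

/-- if `η_i = η_j = 1` and `c > 0`, then
`w(η, G¹)/Z(G¹) > w(η, G⁰)/Z(G⁰)`. -/
theorem prob_ratio_both_one {n : ℕ} (hn : 2 ≤ n) (b : Fin n → ℝ) (c : ℝ) (hc : 0 < c)
    (i j : Fin n) (hij : i ≠ j)
    (G0 G1 : Fin n → Fin n → ℝ)
    (hG0sym : ∀ k l, G0 k l = G0 l k) (hG1sym : ∀ k l, G1 k l = G1 l k)
    (hG0val : ∀ k l, G0 k l = 0 ∨ G0 k l = 1)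
    (hG1val : ∀ k l, G1 k l = 0 ∨ G1 k l = 1)
    (hG1ij : G1 i j = 1) (hG0ij : G0 i j = 0)
    (hagree : ∀ k l, ¬((k = i ∧ l = j) ∨ (k = j ∧ l = i)) → G0 k l = G1 k l)
    (η : Fin n → ℝ) (hη : ∀ k, η k = 0 ∨ η k = 1)
    (hi : η i = 1) (hj : η j = 1) :
    isingW b c η G0 / isingZ b c G0 < isingW b c η G1 / isingZ b c G1 := by
  have hW := isingW_edge b c i j hij G0 G1 hG0sym hG1sym hG1ij hG0ij hagree
  have hpos : ∀ (η : Fin n → ℝ) G, 0 < isingW b c η G := fun η G => Real.exp_pos _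
  have hZpos : ∀ G, 0 < isingZ b c G := fun G =>
    Finset.sum_pos (fun σ _ => hpos _ _) Finset.univ_nonempty
  have hZ : isingZ b c G1 < isingZ b c G0 * Real.exp (2 * c) := by
    unfold isingZ
    rw [Finset.sum_mul]
    apply Finset.sum_lt_sum
    · intro σ _
      rw [hW]
      refine mul_le_mul_of_nonneg_left (Real.exp_le_exp.mpr ?_) (hpos _ _).le
      split_ifs <;> linarith
    · refine ⟨fun _ => false, Finset.mem_univ _, ?_⟩
      rw [hW]
      refine mul_lt_mul_of_pos_left (Real.exp_lt_exp.mpr ?_) (hpos _ _)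
      simpa using hc
  rw [div_lt_div_iff₀ (hZpos _) (hZpos _), hW η, hi, hj, mul_assoc]
  refine mul_lt_mul_of_pos_left ?_ (hpos _ _)
  rw [mul_one, mul_one, mul_comm]
  exact hZ
end

section
/- Let C₁, C₂, C₃, C₄ > 0 and μ > 0. Define for real z, z' the function P₁(z, z') = C₁ φ_μ(z) φ_μ(z') / [C₁ φ_μ(z) φ_μ(z') + C₂ φ_μ(z) φ₀(z') + C₃ φ₀(z) φ_μ(z') + C₄ φ₀(z) φ₀(z')]. Then P₁ is a strictly increasing function of z for every fixed z', and a strictly increasing function of z' for every fixed z. -/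
/-- The density of the normal distribution `N(m, 1)`:
`φ_m(z) = (2π)^{-1/2} exp(−(z−m)²/2)`. -/
noncomputable def gaussPdf (m z : ℝ) : ℝ :=
  (Real.sqrt (2 * Real.pi))⁻¹ * Real.exp (-(z - m) ^ 2 / 2)

theorem gaussPdf_pos (m z : ℝ) : 0 < gaussPdf m z := by
  have := Real.pi_pos
  unfold gaussPdf
  positivity

theorem gaussPdf_ratio (μ x y : ℝ) (hμ : 0 < μ) (h : x < y) :
    gaussPdf μ x * gaussPdf 0 y < gaussPdf μ y * gaussPdf 0 x := by
  have hc : 0 < (Real.sqrt (2 * Real.pi))⁻¹ := by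
    have := Real.pi_pos
    positivity
  unfold gaussPdf
  rw [mul_mul_mul_comm, mul_mul_mul_comm _ _ _ (Real.exp (-(x - 0) ^ 2 / 2)),
    ← Real.exp_add, ← Real.exp_add]
  refine mul_lt_mul_of_pos_left (Real.exp_lt_exp.mpr ?_) (mul_pos hc hc)
  nlinarith [mul_pos hμ (sub_pos.mpr h)]

theorem ratio_aux (A B C D a b a' b' p q : ℝ) (hA : 0 < A) (hB : 0 < B) (hC : 0 < C)
    (hD : 0 < D) (ha : 0 < a) (hb : 0 < b) (ha' : 0 < a') (hb' : 0 < b')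
    (hp : 0 < p) (hq : 0 < q) (h : a * b' < a' * b) :
    A * a * p / (A * a * p + B * a * q + C * b * p + D * b * q) <
      A * a' * p / (A * a' * p + B * a' * q + C * b' * p + D * b' * q) := by
  rw [div_lt_div_iff₀ (by positivity) (by positivity)]
  have hk : 0 < A * p * (C * p + D * q) := by positivity
  have := mul_pos hk (sub_pos.mpr h)
  linarith

/-- Lemma 2 of the paper: the posterior probability
`P₁(z,z') = C₁φ_μ(z)φ_μ(z') / [C₁φ_μ(z)φ_μ(z') + C₂φ_μ(z)φ₀(z') + C₃φ₀(z)φ_μ(z') +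
C₄φ₀(z)φ₀(z')]` is strictly increasing in `z` for fixed `z'` and strictly
increasing in `z'` for fixed `z`. -/
theorem posterior_strictMono (C1 C2 C3 C4 μ : ℝ)
    (hC1 : 0 < C1) (hC2 : 0 < C2) (hC3 : 0 < C3) (hC4 : 0 < C4) (hμ : 0 < μ) :
    (∀ z' : ℝ, StrictMono fun z : ℝ =>
      C1 * gaussPdf μ z * gaussPdf μ z' /
        (C1 * gaussPdf μ z * gaussPdf μ z' + C2 * gaussPdf μ z * gaussPdf 0 z' +
          C3 * gaussPdf 0 z * gaussPdf μ z' + C4 * gaussPdf 0 z * gaussPdf 0 z')) ∧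
    (∀ z : ℝ, StrictMono fun z' : ℝ =>
      C1 * gaussPdf μ z * gaussPdf μ z' /
        (C1 * gaussPdf μ z * gaussPdf μ z' + C2 * gaussPdf μ z * gaussPdf 0 z' +
          C3 * gaussPdf 0 z * gaussPdf μ z' + C4 * gaussPdf 0 z * gaussPdf 0 z')) := by
  constructor
  · intro w x y h
    exact ratio_aux C1 C2 C3 C4 _ _ _ _ _ _ hC1 hC2 hC3 hC4 (gaussPdf_pos _ _) (gaussPdf_pos _ _)
      (gaussPdf_pos _ _) (gaussPdf_pos _ _) (gaussPdf_pos _ _) (gaussPdf_pos _ _)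
      (gaussPdf_ratio μ x y hμ h)
  · intro w x y h
    have := ratio_aux C1 C3 C2 C4 _ _ _ _ (gaussPdf μ w) (gaussPdf 0 w) hC1 hC3 hC2 hC4
      (gaussPdf_pos _ _) (gaussPdf_pos _ _)
      (gaussPdf_pos _ _) (gaussPdf_pos _ _) (gaussPdf_pos _ _) (gaussPdf_pos _ _)
      (gaussPdf_ratio μ x y hμ h)
    beta_reduce
    refine lt_of_eq_of_lt ?_ (lt_of_lt_of_eq this ?_) <;> congr 1 <;> ring
end
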